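/- For a partition λ ∈ P_n with λ_0 := 0, the principal Borel symmetric strongly shifted ideal Sss({λ}) factors as the product ∏_{i=1}^n I_{n,i}^{λ_i − λ_{i−1}}, where I_{n,i} is the square-free Veronese ideal generated by all square-free monomials of degree n − i + 1. -/

import Mathlib

open MvPolynomial

/-- The monomial `x^a` in `K[x_1,...,x_n]`. -/
noncomputable def mon (K : Type) [Field K] (n : ℕ) (a : Fin n → ℕ) :
    MvPolynomial (Fin n) K :=
  monomial (Finsupp.equivFunOnFinite.symm a) 1

/-- A monomial ideal: an ideal generated by monomials. -/
def IsMonomialIdeal (K : Type) [Field K] (n : ℕ)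
    (I : Ideal (MvPolynomial (Fin n) K)) : Prop :=
  ∃ S : Set (Fin n → ℕ), I = Ideal.span (mon K n '' S)

/-- A symmetric (`𝔖_n`-fixed) ideal. -/
def IsSymmetricIdeal (K : Type) [Field K] (n : ℕ)
    (I : Ideal (MvPolynomial (Fin n) K)) : Prop :=
  ∀ σ : Equiv.Perm (Fin n), Ideal.map (rename (σ : Fin n → Fin n)) I = I

/-- The exponent vector obtained from `a` by the Borel move `x^a ↦ x^a · x_i / x_j`. -/
def borelMoveVec (n : ℕ) (a : Fin n → ℕ) (i j : Fin n) : Fin n → ℕ :=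
  fun k => if k = i then a k + 1 else if k = j then a k - 1 else a k

/-- A symmetric strongly shifted ideal (sssi). -/
def IsSSSI (K : Type) [Field K] (n : ℕ)
    (I : Ideal (MvPolynomial (Fin n) K)) : Prop :=
  IsMonomialIdeal K n I ∧ IsSymmetricIdeal K n I ∧
    ∀ lam : Fin n → ℕ, Monotone lam → mon K n lam ∈ I →
      ∀ i j : Fin n, i < j → lam i < lam j →
        mon K n (borelMoveVec n lam i j) ∈ I

/-- The dominance order on partitions: `μ ⊴ λ`. -/
def dominates (n : ℕ) (μ lam : Fin n → ℕ) : Prop :=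
  ∀ k : Fin n, ∑ i ∈ Finset.Ici k, μ i ≤ ∑ i ∈ Finset.Ici k, lam i

/-- `Sss(B)`: the smallest symmetric strongly shifted ideal containing the
monomials `x^λ`, `λ ∈ B`. -/
noncomputable def Sss (K : Type) [Field K] (n : ℕ) (B : Set (Fin n → ℕ)) :
    Ideal (MvPolynomial (Fin n) K) :=
  sInf {J | IsSSSI K n J ∧ ∀ lam ∈ B, mon K n lam ∈ J}

/-- The square-free Veronese ideal `I_{n,c}`, generated by all square-free
monomials of degree `n − c + 1`. -/
noncomputable def vero (K : Type) [Field K] (n c : ℕ) :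
    Ideal (MvPolynomial (Fin n) K) :=
  Ideal.span (mon K n '' {a | (∀ i, a i ≤ 1) ∧ ∑ i, a i = n - c + 1})

/-- The families of square-free exponent vectors, with `c i` vectors of degree `n - i` for each
`i`. -/
def IsVeroFamily {n : ℕ} (c : Fin n → ℕ) (A : (Σ i : Fin n, Fin (c i)) → Fin n → ℕ) : Prop :=
  ∀ t, (∀ k, A t k ≤ 1) ∧ ∑ k, A t k = n - ((t.1 : ℕ) + 1) + 1

/-- The sums of the families of square-free exponent vectors prescribed by `c`. -/
def veroSums {n : ℕ} (c : Fin n → ℕ) : Set (Fin n → ℕ) :=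
  {a | ∃ A, IsVeroFamily c A ∧ ∑ t, A t = a}

theorem mon_add (K : Type) [Field K] (n : ℕ) (a b : Fin n → ℕ) :
    mon K n (a + b) = mon K n a * mon K n b := by
  simp only [mon, monomial_mul, one_mul]
  congr 2
  ext
  simp

theorem mon_sum (K : Type) [Field K] (n : ℕ) {ι : Type*} (s : Finset ι) (A : ι → Fin n → ℕ) :
    mon K n (∑ t ∈ s, A t) = ∏ t ∈ s, mon K n (A t) := by
  classical
  induction s using Finset.induction_on with
  | empty =>
    have h : (Finsupp.equivFunOnFinite.symm 0 : Fin n →₀ ℕ) = 0 := by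
      ext
      simp
    rw [Finset.sum_empty, Finset.prod_empty, mon, h, monomial_zero', C_1]
  | insert t s ht ih => rw [Finset.sum_insert ht, Finset.prod_insert ht, mon_add, ih]

theorem rename_mon (K : Type) [Field K] (n : ℕ) (σ : Equiv.Perm (Fin n)) (a : Fin n → ℕ) :
    rename (σ : Fin n → Fin n) (mon K n a) = mon K n (a ∘ σ.symm) := by
  simp only [mon, rename_monomial]
  congr 2
  ext k
  obtain ⟨k, rfl⟩ := σ.surjective k
  rw [Finsupp.mapDomain_apply σ.injective]
  simp

theorem mon_mem_span_iff (K : Type) [Field K] (n : ℕ) (S : Set (Fin n → ℕ)) (a : Fin n → ℕ) :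
    mon K n a ∈ Ideal.span (mon K n '' S) ↔ ∃ s ∈ S, s ≤ a := by
  constructor
  · intro h
    have h' : mon K n a ∈ Ideal.span ((fun s => monomial s (1 : K)) ''
        (Finsupp.equivFunOnFinite.symm '' S)) := by
      rwa [Set.image_image]
    rw [mem_ideal_span_monomial_image] at h'
    obtain ⟨_, ⟨s, hs, rfl⟩, hle⟩ := h' (Finsupp.equivFunOnFinite.symm a) (by
      classical
      simp [mon, support_monomial])
    exact ⟨s, hs, fun k => hle k⟩
  · rintro ⟨s, hs, hle⟩
    obtain ⟨b, rfl⟩ := exists_add_of_le hle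
    rw [mon_add]
    exact Ideal.mul_mem_right _ _ (Ideal.subset_span ⟨s, hs, rfl⟩)

theorem prod_vero_eq_span (K : Type) [Field K] (n : ℕ) (c : Fin n → ℕ) :
    ∏ i : Fin n, vero K n ((i : ℕ) + 1) ^ c i = Ideal.span (mon K n '' veroSums c) := by
  have h : ∏ i : Fin n, vero K n ((i : ℕ) + 1) ^ c i =
      ∏ t : (Σ i : Fin n, Fin (c i)), vero K n ((t.1 : ℕ) + 1) := by
    rw [Fintype.prod_sigma]
    simp
  rw [h]
  simp only [vero]
  rw [Ideal.prod_span]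
  congr 1
  ext p
  rw [Set.mem_fintype_prod]
  constructor
  · rintro ⟨g, hg, rfl⟩
    choose A hA hAg using hg
    refine ⟨_, ⟨A, hA, rfl⟩, ?_⟩
    rw [mon_sum]
    exact Finset.prod_congr rfl fun t _ => hAg t
  · rintro ⟨_, ⟨A, hA, rfl⟩, rfl⟩
    exact ⟨fun t => mon K n (A t), fun t => ⟨A t, hA t, rfl⟩, (mon_sum K n _ A).symm⟩

theorem IsVeroFamily.comp_perm {n : ℕ} {c : Fin n → ℕ}
    {A : (Σ i : Fin n, Fin (c i)) → Fin n → ℕ} (hA : IsVeroFamily c A)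
    (σ : Equiv.Perm (Fin n)) : IsVeroFamily c (fun t => A t ∘ σ) := fun t =>
  ⟨fun k => (hA t).1 (σ k), by rw [← (hA t).2]; exact Equiv.sum_comp σ (A t)⟩

theorem comp_perm_mem_veroSums {n : ℕ} {c : Fin n → ℕ} {a : Fin n → ℕ} (ha : a ∈ veroSums c)
    (σ : Equiv.Perm (Fin n)) : a ∘ σ ∈ veroSums c := by
  obtain ⟨A, hA, rfl⟩ := ha
  exact ⟨_, hA.comp_perm σ, by ext k; simp [Finset.sum_apply]⟩

theorem borelMoveVec_add_single {n : ℕ} (a : Fin n → ℕ) {i j : Fin n} (hij : i ≠ j) (hj : 0 < a j) :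
    borelMoveVec n a i j + Pi.single j 1 = a + Pi.single i 1 := by
  ext k
  simp only [borelMoveVec, Pi.add_apply, Pi.single_apply]
  split_ifs <;> subst_vars <;> omega

/-- A Borel move at the vector with index `t` keeps a family of square-free vectors. -/
theorem IsVeroFamily.update {n : ℕ} {c : Fin n → ℕ}
    {A : (Σ i : Fin n, Fin (c i)) → Fin n → ℕ} (hA : IsVeroFamily c A)
    {t : Σ i : Fin n, Fin (c i)} {i j : Fin n} (hij : A t i < A t j) :
    IsVeroFamily c (Function.update A t (borelMoveVec n (A t) i j)) := by
  intro s
  by_cases hs : s = t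
  · subst hs
    rw [Function.update_self]
    have hne : i ≠ j := by rintro rfl; exact lt_irrefl _ hij
    refine ⟨fun k => ?_, ?_⟩
    · have h1 := (hA s).1 k
      have h2 := (hA s).1 j
      simp only [borelMoveVec]
      split_ifs <;> subst_vars <;> omega
    · have h := congrArg (fun f : Fin n → ℕ => ∑ k, f k) (borelMoveVec_add_single (A s) hne (by omega))
      simp only [Pi.add_apply, Finset.sum_add_distrib, Finset.sum_pi_single', Finset.mem_univ,
        if_true] at h
      rw [← (hA s).2]
      omega
  · rw [Function.update_of_ne hs]
    exact hA s

theorem sum_update_borelMoveVec {n : ℕ} {ι : Type*} [Fintype ι] [DecidableEq ι]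
    (A : ι → Fin n → ℕ) {t : ι} {i j : Fin n} (hij : A t i < A t j) :
    ∑ s, Function.update A t (borelMoveVec n (A t) i j) s = borelMoveVec n (∑ s, A s) i j := by
  have hne : i ≠ j := by rintro rfl; exact lt_irrefl _ hij
  have hle : A t j ≤ (∑ s, A s) j := by
    rw [Finset.sum_apply]
    exact Finset.single_le_sum (f := fun s => A s j) (fun _ _ => Nat.zero_le _) (Finset.mem_univ t)
  have h1 := borelMoveVec_add_single (A t) hne (by omega)
  have h2 := borelMoveVec_add_single (∑ s, A s) hne (by omega)
  rw [Finset.sum_update_of_mem (Finset.mem_univ t)]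
  apply add_right_cancel (b := Pi.single j 1)
  rw [h2, add_right_comm, h1, ← Finset.add_sum_erase _ A (Finset.mem_univ t),
    Finset.sdiff_singleton_eq_erase]
  abel

theorem isSSSI_span_veroSums (K : Type) [Field K] (n : ℕ) (c : Fin n → ℕ) :
    IsSSSI K n (Ideal.span (mon K n '' veroSums c)) := by
  classical
  refine ⟨⟨_, rfl⟩, ?_, ?_⟩
  · have hle : ∀ σ : Equiv.Perm (Fin n), Ideal.map (rename (σ : Fin n → Fin n))
        (Ideal.span (mon K n '' veroSums c)) ≤ Ideal.span (mon K n '' veroSums c) := by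
      intro σ
      rw [Ideal.map_span, Ideal.span_le]
      rintro _ ⟨_, ⟨a, ha, rfl⟩, rfl⟩
      exact Ideal.subset_span ⟨_, comp_perm_mem_veroSums ha σ.symm, (rename_mon K n σ a).symm⟩
    intro σ
    refine le_antisymm (hle σ) ?_
    rw [Ideal.span_le]
    rintro _ ⟨a, ha, rfl⟩
    have h : mon K n a = rename (σ : Fin n → Fin n) (mon K n (a ∘ σ)) := by
      rw [rename_mon, Function.comp_assoc, Equiv.self_comp_symm, Function.comp_id]
    rw [h]
    exact Ideal.mem_map_of_mem _ (Ideal.subset_span ⟨_, comp_perm_mem_veroSums ha σ, rfl⟩)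
  · intro a _ ha i j hij hlt
    rw [mon_mem_span_iff] at ha ⊢
    obtain ⟨_, ⟨A, hA, rfl⟩, hle⟩ := ha
    by_cases hA' : ∃ t, A t i < A t j
    · obtain ⟨t, ht⟩ := hA'
      refine ⟨_, ⟨_, hA.update ht, sum_update_borelMoveVec A ht⟩, fun k => ?_⟩
      have := hle k
      simp only [borelMoveVec]
      split_ifs <;> first | assumption | exact Nat.add_le_add_right this 1 |
        exact Nat.sub_le_sub_right this 1
    · push Not at hA'
      refine ⟨_, ⟨A, hA, rfl⟩, fun k => ?_⟩
      have h : (∑ t, A t) j ≤ (∑ t, A t) i := by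
        simp only [Finset.sum_apply]
        exact Finset.sum_le_sum fun t _ => hA' t
      have hi := hle i
      have hk := hle k
      simp only [borelMoveVec]
      split_ifs with h1 h2
      · exact hk.trans (Nat.le_succ _)
      · rw [h2]
        exact Nat.le_sub_one_of_lt (h.trans_lt (hi.trans_lt hlt))
      · exact hk

theorem IsSymmetricIdeal.mon_comp_perm_mem {K : Type} [Field K] {n : ℕ}
    {J : Ideal (MvPolynomial (Fin n) K)} (hJ : IsSymmetricIdeal K n J) {a : Fin n → ℕ}
    (ha : mon K n a ∈ J) (σ : Equiv.Perm (Fin n)) : mon K n (a ∘ σ) ∈ J := by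
  have h := Ideal.mem_map_of_mem (rename (σ.symm : Fin n → Fin n)) ha
  rwa [rename_mon, hJ σ.symm] at h

/-- In a symmetric strongly shifted ideal, Borel moves are allowed without sorting first. -/
theorem IsSSSI.mon_borelMoveVec_mem {K : Type} [Field K] {n : ℕ}
    {J : Ideal (MvPolynomial (Fin n) K)} (hJ : IsSSSI K n J) {a : Fin n → ℕ}
    (ha : mon K n a ∈ J) {i j : Fin n} (hij : a i < a j) :
    mon K n (borelMoveVec n a i j) ∈ J := by
  have hmono : Monotone (a ∘ Tuple.sort a) := Tuple.monotone_sort a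
  set σ := Tuple.sort a
  have hlt : (a ∘ σ) (σ.symm i) < (a ∘ σ) (σ.symm j) := by simpa using hij
  have h := hJ.2.1.mon_comp_perm_mem (hJ.2.2 _ hmono (hJ.2.1.mon_comp_perm_mem ha σ)
    (σ.symm i) (σ.symm j) (hmono.reflect_lt hlt) hlt) σ.symm
  convert h using 2
  ext k
  simp [borelMoveVec]

theorem eq_ite_of_monotone_of_le_one {n : ℕ} {f : Fin n → ℕ} (hf : Monotone f)
    (h1 : ∀ k, f k ≤ 1) {i : Fin n} (hsum : ∑ k, f k = n - ((i : ℕ) + 1) + 1) (k : Fin n) :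
    f k = if i ≤ k then 1 else 0 := by
  rcases Nat.le_one_iff_eq_zero_or_eq_one.1 (h1 k) with h0 | h0
  · have : ∑ l, f l ≤ ∑ l ∈ Finset.Ioi k, 1 := by
      rw [← Finset.sum_subset (Finset.subset_univ (Finset.Ioi k))]
      · exact Finset.sum_le_sum fun l _ => h1 l
      · intro l _ hl
        have := hf (not_lt.1 fun h => hl (Finset.mem_Ioi.2 h))
        omega
    simp only [Finset.sum_const, Fin.card_Ioi, smul_eq_mul, mul_one] at this
    rw [h0, if_neg]
    rw [Fin.le_def]
    omega
  · have : ∑ l ∈ Finset.Ici k, 1 ≤ ∑ l, f l := by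
      refine le_trans (Finset.sum_le_sum fun l hl => ?_)
        (Finset.sum_le_sum_of_subset (Finset.subset_univ (Finset.Ici k)))
      rw [← h0]
      exact hf (Finset.mem_Ici.1 hl)
    simp only [Finset.sum_const, Fin.card_Ici, smul_eq_mul, mul_one] at this
    rw [h0, if_pos]
    rw [Fin.le_def]
    omega

theorem sum_ite_le_of_monotone {n : ℕ} {lam : Fin n → ℕ} (hlam : Monotone lam) (m : ℕ)
    (hm : m < n) :
    ∑ i : Fin n, (if (i : ℕ) ≤ m then
      (lam i - if (i : ℕ) = 0 then 0
        else lam ⟨(i : ℕ) - 1, lt_of_le_of_lt (Nat.sub_le _ _) i.isLt⟩) else 0) =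
      lam ⟨m, hm⟩ := by
  induction m with
  | zero =>
    rw [Finset.sum_eq_single ⟨0, hm⟩]
    · simp
    · intro i _ hi
      rw [if_neg]
      intro h
      exact hi (Fin.ext (Nat.le_zero.1 h))
    · simp
  | succ m ih =>
    rw [← Finset.add_sum_erase _ _ (Finset.mem_univ (⟨m + 1, hm⟩ : Fin n))]
    have ih := ih (by omega)
    rw [← Finset.add_sum_erase _ _ (Finset.mem_univ (⟨m + 1, hm⟩ : Fin n))] at ih
    have hle : lam ⟨m, by omega⟩ ≤ lam ⟨m + 1, hm⟩ := hlam (by simp [Fin.le_def])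
    rw [if_neg (by simp), zero_add] at ih
    rw [Finset.sum_congr rfl (g := fun i : Fin n => if (i : ℕ) ≤ m then
      (lam i - if (i : ℕ) = 0 then 0
        else lam ⟨(i : ℕ) - 1, lt_of_le_of_lt (Nat.sub_le _ _) i.isLt⟩) else 0), ih]
    · simp only [le_refl, if_true, Nat.add_one_ne_zero, if_false, Nat.add_sub_cancel]
      omega
    · intro i hi
      have : (i : ℕ) ≠ m + 1 := fun h => (Finset.mem_erase.1 hi).1 (Fin.ext h)
      exact if_congr (by omega) rfl rfl

theorem sum_eq_of_monotone {n : ℕ} {c lam : Fin n → ℕ}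
    (hc : ∀ k : Fin n, ∑ i : Fin n, (if i ≤ k then c i else 0) = lam k)
    {A : (Σ i : Fin n, Fin (c i)) → Fin n → ℕ} (hA : IsVeroFamily c A)
    (hmono : ∀ t, Monotone (A t)) : ∑ t, A t = lam := by
  ext k
  rw [Finset.sum_apply, ← hc k, Fintype.sum_sigma]
  refine Finset.sum_congr rfl fun i _ => ?_
  rw [Finset.sum_congr rfl fun s _ =>
    eq_ite_of_monotone_of_le_one (hmono ⟨i, s⟩) (hA ⟨i, s⟩).1 (hA ⟨i, s⟩).2 k]
  split_ifs <;> simp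

theorem mem_veroSums {n : ℕ} {c lam : Fin n → ℕ}
    (hc : ∀ k : Fin n, ∑ i : Fin n, (if i ≤ k then c i else 0) = lam k) : lam ∈ veroSums c := by
  have hA : IsVeroFamily c (fun t k => if t.1 ≤ k then 1 else 0) := by
    intro t
    refine ⟨fun k => by dsimp only; split_ifs <;> simp, ?_⟩
    have h : Finset.univ.filter (fun k => t.1 ≤ k) = Finset.Ici t.1 := by ext; simp
    simp only [Finset.sum_boole, h, Fin.card_Ici, Nat.cast_id]
    omega
  refine ⟨_, hA, sum_eq_of_monotone hc hA fun t k l hkl => ?_⟩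
  split_ifs with h1 h2
  · exact le_rfl
  · exact absurd (h1.trans hkl) h2
  · exact Nat.zero_le _
  · exact le_rfl

theorem sum_sq_lt_sum_sq_borelMoveVec {n : ℕ} {a : Fin n → ℕ} {i j : Fin n} (hne : i ≠ j)
    (hj : 0 < a j) (hle : a j ≤ a i) :
    ∑ k, a k ^ 2 < ∑ k, borelMoveVec n a i j k ^ 2 := by
  have hj' : j ∈ Finset.univ.erase i := Finset.mem_erase.2 ⟨hne.symm, Finset.mem_univ j⟩
  rw [← Finset.add_sum_erase _ _ (Finset.mem_univ i), ← Finset.add_sum_erase _ _ hj',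
    ← Finset.add_sum_erase _ (fun k => borelMoveVec n a i j k ^ 2) (Finset.mem_univ i),
    ← Finset.add_sum_erase _ (fun k => borelMoveVec n a i j k ^ 2) hj',
    Finset.sum_congr rfl (s₁ := (Finset.univ.erase i).erase j)
      (f := fun k => borelMoveVec n a i j k ^ 2) (g := fun k => a k ^ 2)]
  · obtain ⟨b, hb⟩ := Nat.exists_eq_add_of_lt hj
    simp only [borelMoveVec, if_true, if_neg hne.symm]
    rw [hb] at hle ⊢
    simp only [Nat.add_sub_cancel]
    nlinarith
  · intro k hk
    simp only [Finset.mem_erase] at hk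
    simp [borelMoveVec, hk.1, hk.2.1]

theorem borelMoveVec_borelMoveVec {n : ℕ} {a : Fin n → ℕ} {i j : Fin n} (hne : i ≠ j)
    (hj : 0 < a j) : borelMoveVec n (borelMoveVec n a i j) j i = a := by
  ext k
  simp only [borelMoveVec]
  split_ifs <;> subst_vars <;> omega

theorem IsVeroFamily.sum_le_card {n : ℕ} {c : Fin n → ℕ}
    {A : (Σ i : Fin n, Fin (c i)) → Fin n → ℕ} (hA : IsVeroFamily c A) (k : Fin n) :
    (∑ t, A t) k ≤ Fintype.card (Σ i : Fin n, Fin (c i)) := by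
  rw [Finset.sum_apply]
  refine (Finset.sum_le_sum fun t _ => (hA t).1 k).trans ?_
  simp

theorem IsSSSI.mon_sum_mem {K : Type} [Field K] {n : ℕ} {J : Ideal (MvPolynomial (Fin n) K)}
    (hJ : IsSSSI K n J) {c lam : Fin n → ℕ}
    (hc : ∀ k : Fin n, ∑ i : Fin n, (if i ≤ k then c i else 0) = lam k)
    (hlam : mon K n lam ∈ J) (A : (Σ i : Fin n, Fin (c i)) → Fin n → ℕ)
    (hA : IsVeroFamily c A) : mon K n (∑ t, A t) ∈ J := by
  classical
  set N := n * Fintype.card (Σ i : Fin n, Fin (c i)) ^ 2 with hN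
  induction hd : N - ∑ k, (∑ t, A t) k ^ 2 using Nat.strong_induction_on generalizing A with
  | _ d ih =>
    by_cases h : ∀ t i j, (∑ t, A t) i ≤ (∑ t, A t) j → A t i ≤ A t j
    · have hmono : Monotone ((∑ t, A t) ∘ Tuple.sort (∑ t, A t)) := Tuple.monotone_sort _
      set σ := Tuple.sort (∑ t, A t)
      have hs := sum_eq_of_monotone hc (hA.comp_perm σ) fun t i j hij => h t _ _ (hmono hij)
      have := hJ.2.1.mon_comp_perm_mem hlam σ.symm
      convert this using 2
      rw [← hs]
      ext k
      simp [Finset.sum_apply]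
    · push Not at h
      obtain ⟨t, j, i, hle, hlt⟩ := h
      have hne : i ≠ j := by rintro rfl; exact lt_irrefl _ hlt
      have hpos : 0 < (∑ s, A s) j := by
        rw [Finset.sum_apply]
        exact Finset.sum_pos' (fun _ _ => Nat.zero_le _) ⟨t, Finset.mem_univ t, by omega⟩
      have hA' := hA.update hlt
      have hsum := sum_update_borelMoveVec A hlt
      have hsq := sum_sq_lt_sum_sq_borelMoveVec hne hpos hle
      have hbd : ∑ k, borelMoveVec n (∑ s, A s) i j k ^ 2 ≤ N := by
        rw [← hsum, hN]
        refine (Finset.sum_le_sum fun k _ => Nat.pow_le_pow_left (hA'.sum_le_card k) 2).trans ?_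
        simp
      have hmem := ih _ (by rw [hsum]; omega) _ hA' rfl
      rw [hsum] at hmem
      rw [← borelMoveVec_borelMoveVec hne hpos]
      refine hJ.mon_borelMoveVec_mem hmem ?_
      simp only [borelMoveVec, if_true, if_neg hne.symm]
      omega

/-- For a partition `λ ∈ P_n` (with the convention `λ_0 = 0`), the principal
Borel symmetric strongly shifted ideal `Sss({λ})` factors as the product
`∏_{i=1}^n I_{n,i}^{λ_i − λ_{i−1}}` of powers of square-free Veronese ideals. -/
theorem principalBorel_eq_product_of_veronese (K : Type) [Field K] (n : ℕ)
    (lam : Fin n → ℕ) (hlam : Monotone lam) :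
    Sss K n {lam} =
      ∏ i : Fin n,
        vero K n ((i : ℕ) + 1) ^
          (lam i -
            if (i : ℕ) = 0 then 0
            else lam ⟨(i : ℕ) - 1, lt_of_le_of_lt (Nat.sub_le _ _) i.isLt⟩) := by
  have hc := fun k : Fin n => sum_ite_le_of_monotone hlam k k.isLt
  rw [prod_vero_eq_span]
  apply le_antisymm
  · refine sInf_le ⟨isSSSI_span_veroSums K n _, ?_⟩
    rintro _ rfl
    exact Ideal.subset_span ⟨_, mem_veroSums hc, rfl⟩
  · refine le_sInf fun J hJ => ?_
    rw [Ideal.span_le]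
    rintro _ ⟨_, ⟨A, hA, rfl⟩, rfl⟩
    exact hJ.1.mon_sum_mem hc (hJ.2 lam rfl) A hA
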